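/- Let M ≥ N ≥ 2 and 1 ≤ k ≤ N−1, with all Dunkl operators built from the M variables z_1,…,z_M. Then there exists an F-linear operator A on F[z_1,…,z_M] such that for every polynomial f ∈ F[z_1,…,z_M] that is symmetric in the variables z_1,…,z_N: [Ñ_{k+1}, B⁺_{k,{1,…,N}}] f = A ( Ñ_{k+1} f ). -/

import Mathlib

open MvPolynomial Finset

section CSDefs

variable {F : Type*} [Field F] [CharZero F]

/-- Exact division in a polynomial ring: `divExact d f = f / d` when `d ∣ f`, junk otherwise. -/
noncomputable def divExact {σ : Type*} (d f : MvPolynomial σ F) : MvPolynomial σ F := by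
  classical exact if h : ∃ c, f = d * c then h.choose else 0

/-- The exchange operator `K_{ij}` permuting the variables `z_i` and `z_j`. -/
noncomputable def Kswap {N : ℕ} (i j : Fin N) (f : MvPolynomial (Fin N) F) :
    MvPolynomial (Fin N) F :=
  rename (Equiv.swap i j) f

/-- The Dunkl operator `∇_i = ∂_i + β ∑_{j ≠ i} (z_i - z_j)⁻¹ (1 - K_{ij})`. -/
noncomputable def nabla {N : ℕ} (β : F) (i : Fin N) (f : MvPolynomial (Fin N) F) :
    MvPolynomial (Fin N) F :=
  pderiv i f + β • ∑ j ∈ Finset.univ.erase i, divExact (X i - X j) (f - Kswap i j f)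

/-- `D_i = z_i ∇_i`. -/
noncomputable def Dop {N : ℕ} (β : F) (i : Fin N) (f : MvPolynomial (Fin N) F) :
    MvPolynomial (Fin N) F :=
  X i * nabla β i f

/-- `(D_{j₁} + kβ)(D_{j₂} + (k+1)β) ⋯` applied along a list of indices. -/
noncomputable def Dlist {N : ℕ} (β : F) :
    ℕ → List (Fin N) → MvPolynomial (Fin N) F → MvPolynomial (Fin N) F
  | _, [], f => f
  | k, j :: rest, f => Dop β j (Dlist β (k + 1) rest f) + ((k : F) * β) • Dlist β (k + 1) rest f

/-- `D_{k,J} = (D_{j₁} + kβ)(D_{j₂} + (k+1)β) ⋯ (D_{j_ℓ} + (k+ℓ-1)β)` for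
`J = {j₁ < j₂ < … < j_ℓ}`. -/
noncomputable def DJ {N : ℕ} (β : F) (k : ℕ) (J : Finset (Fin N))
    (f : MvPolynomial (Fin N) F) : MvPolynomial (Fin N) F :=
  Dlist β k (J.sort (· ≤ ·)) f

/-- `z_J = ∏_{i ∈ J} z_i`. -/
noncomputable def zJ {N : ℕ} (J : Finset (Fin N)) : MvPolynomial (Fin N) F := ∏ i ∈ J, X i

/-- The creation operator `B⁺_{i,J} = ∑_{J' ⊆ J, |J'| = i} z_{J'} D_{1,J'}`. -/
noncomputable def Bplus {N : ℕ} (β : F) (i : ℕ) (J : Finset (Fin N))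
    (f : MvPolynomial (Fin N) F) : MvPolynomial (Fin N) F :=
  ∑ J' ∈ J.powersetCard i, zJ J' * DJ β 1 J' f

/-- `A_{ij} = ((z_i+z_j)/(z_i-z_j))(z_i ∂_i - z_j ∂_j)`. -/
noncomputable def Aop {N : ℕ} (i j : Fin N) (f : MvPolynomial (Fin N) F) :
    MvPolynomial (Fin N) F :=
  divExact (X i - X j) ((X i + X j) * (X i * pderiv i f - X j * pderiv j f))

/-- `H^{(S)} = ∑_{i ∈ S} (z_i ∂_i)² + β ∑_{i<j, i,j ∈ S} A_{ij}`. -/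
noncomputable def Hop {N : ℕ} (β : F) (S : Finset (Fin N)) (f : MvPolynomial (Fin N) F) :
    MvPolynomial (Fin N) F :=
  ∑ i ∈ S, X i * pderiv i (X i * pderiv i f)
    + β • ∑ i ∈ S, ∑ j ∈ S.filter (fun j => i < j), Aop i j f

/-- A polynomial is symmetric in the variables indexed by `S`. -/
def SymmOn {N : ℕ} (S : Finset (Fin N)) (f : MvPolynomial (Fin N) F) : Prop :=
  ∀ i ∈ S, ∀ j ∈ S, rename (Equiv.swap i j) f = f

/-- `phiCS β N lam i = (B⁺_i)^{λ_i - λ_{i+1}} ⋯ (B⁺_1)^{λ_1 - λ_2} · 1`,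
where `lam` is 0-indexed: `lam (j-1) = λ_j`. -/
noncomputable def phiCS (β : F) (N : ℕ) (lam : ℕ → ℕ) : ℕ → MvPolynomial (Fin N) F
  | 0 => 1
  | i + 1 => (fun f => Bplus β (i + 1) Finset.univ f)^[lam i - lam (i + 1)] (phiCS β N lam i)

/-- The monomial symmetric polynomial attached to an exponent vector. -/
noncomputable def msym (N : ℕ) (lam : Fin N → ℕ) : MvPolynomial (Fin N) F := by
  classical
  exact ∑ v ∈ (Finset.univ : Finset (Equiv.Perm (Fin N))).image
      (fun σ => fun i => lam (σ i)), ∏ i, X i ^ v i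

/-- `𝐷̂_i = D_i + β(i-1) - β ∑_{j<i} (1 - K_{ij})` (0-indexed: `i-1` becomes `i`). -/
noncomputable def Dhat {N : ℕ} (β : F) (i : Fin N) (f : MvPolynomial (Fin N) F) :
    MvPolynomial (Fin N) F :=
  Dop β i f + (β * ((i : ℕ) : F)) • f
    - β • ∑ j ∈ Finset.univ.filter (fun j => j < i), (f - Kswap i j f)

end CSDefs

section DunklAlgebra

variable {F : Type*} [Field F] {M : ℕ}

/-- The automorphism of the polynomial ring permuting the variables by `σ`. -/
noncomputable def permEnd (F : Type*) [Field F] {M : ℕ} (σ : Equiv.Perm (Fin M)) :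
    Module.End F (MvPolynomial (Fin M) F) :=
  (rename σ).toLinearMap

theorem permEnd_apply (σ : Equiv.Perm (Fin M)) (f : MvPolynomial (Fin M) F) :
    permEnd F σ f = rename σ f := rfl

theorem permEnd_mul (σ τ : Equiv.Perm (Fin M)) :
    permEnd F σ * permEnd F τ = permEnd F (σ * τ) := by
  refine LinearMap.ext fun f => ?_
  simp [permEnd_apply, rename_rename]

theorem permEnd_map_mul (σ : Equiv.Perm (Fin M)) (f g : MvPolynomial (Fin M) F) :
    permEnd F σ (f * g) = permEnd F σ f * permEnd F σ g := by
  simp [permEnd_apply]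

theorem permEnd_X (σ : Equiv.Perm (Fin M)) (i : Fin M) :
    permEnd F σ (X i) = X (σ i) := by
  simp [permEnd_apply]

/-- The exchange operator `K_{ij}` as a linear endomorphism. -/
noncomputable abbrev swapEnd (F : Type*) [Field F] {M : ℕ} (i j : Fin M) :
    Module.End F (MvPolynomial (Fin M) F) :=
  permEnd F (Equiv.swap i j)

theorem swapEnd_comm (i j : Fin M) : swapEnd F i j = swapEnd F j i := by
  rw [swapEnd, Equiv.swap_comm]

theorem X_sub_X_ne_zero {i j : Fin M} (h : i ≠ j) :
    (X i - X j : MvPolynomial (Fin M) F) ≠ 0 :=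
  sub_ne_zero.mpr fun e => h (X_injective e)

theorem X_sub_X_dvd_sub_swap (i j : Fin M) (f : MvPolynomial (Fin M) F) :
    (X i - X j : MvPolynomial (Fin M) F) ∣ f - swapEnd F i j f := by
  induction f using MvPolynomial.induction_on with
  | C a => simp [permEnd_apply]
  | add p q hp hq =>
    rw [map_add, add_sub_add_comm]
    exact dvd_add hp hq
  | mul_X p n hp =>
    have hX : (X i - X j : MvPolynomial (Fin M) F) ∣ X n - X (Equiv.swap i j n) := by
      rcases eq_or_ne n i with rfl | hi
      · simp
      rcases eq_or_ne n j with rfl | hj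
      · rw [Equiv.swap_apply_right]
        exact ⟨-1, by ring⟩
      · simp [Equiv.swap_apply_of_ne_of_ne hi hj]
    rw [permEnd_map_mul, permEnd_X]
    have : p * X n - swapEnd F i j p * X (Equiv.swap i j n)
        = (p - swapEnd F i j p) * X n
          + swapEnd F i j p * (X n - X (Equiv.swap i j n)) := by ring
    rw [this]
    exact dvd_add (hp.mul_right _) (hX.mul_left _)

theorem mul_divExact {d f : MvPolynomial (Fin M) F} (h : d ∣ f) : d * divExact d f = f := by
  have h' : ∃ c, f = d * c := h
  rw [divExact, dif_pos h']
  exact h'.choose_spec.symm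

theorem X_sub_X_mul_divExact (i j : Fin M) (f : MvPolynomial (Fin M) F) :
    (X i - X j) * divExact (X i - X j) (f - swapEnd F i j f) = f - swapEnd F i j f :=
  mul_divExact (X_sub_X_dvd_sub_swap i j f)

/-- The divided difference `(z_i - z_j)⁻¹ (1 - K_{ij})` as a linear endomorphism
(zero for `i = j`). -/
noncomputable def divDiff (F : Type*) [Field F] {M : ℕ} (i j : Fin M) :
    Module.End F (MvPolynomial (Fin M) F) :=
  if h : i = j then 0 else
  { toFun := fun f => divExact (X i - X j) (f - swapEnd F i j f)
    map_add' := fun f g => by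
      apply mul_left_cancel₀ (X_sub_X_ne_zero h)
      rw [mul_add, X_sub_X_mul_divExact, X_sub_X_mul_divExact, X_sub_X_mul_divExact, map_add]
      ring
    map_smul' := fun c f => by
      apply mul_left_cancel₀ (X_sub_X_ne_zero h)
      rw [RingHom.id_apply, mul_smul_comm, X_sub_X_mul_divExact, X_sub_X_mul_divExact, map_smul,
        smul_sub] }

theorem divDiff_apply {i j : Fin M} (h : i ≠ j) (f : MvPolynomial (Fin M) F) :
    divDiff F i j f = divExact (X i - X j) (f - swapEnd F i j f) := by
  rw [divDiff, dif_neg h]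
  rfl

theorem divDiff_eq_iff {i j : Fin M} (h : i ≠ j) (f q : MvPolynomial (Fin M) F) :
    divDiff F i j f = q ↔ (X i - X j) * q = f - swapEnd F i j f := by
  rw [divDiff_apply h, ← mul_right_inj' (X_sub_X_ne_zero h), X_sub_X_mul_divExact, eq_comm]

theorem X_sub_X_mul_divDiff {i j : Fin M} (h : i ≠ j) (f : MvPolynomial (Fin M) F) :
    (X i - X j) * divDiff F i j f = f - swapEnd F i j f :=
  (divDiff_eq_iff h _ _).mp rfl

theorem divDiff_X_mul {i j : Fin M} (h : i ≠ j) (l : Fin M) (f : MvPolynomial (Fin M) F) :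
    divDiff F i j (X l * f) = X l * divDiff F i j f
      + ((if l = i then 1 else 0) - (if l = j then 1 else 0)) * swapEnd F i j f := by
  rw [divDiff_eq_iff h, mul_add, mul_left_comm, X_sub_X_mul_divDiff h, permEnd_map_mul, permEnd_X]
  rcases eq_or_ne l i with rfl | hi
  · simp [h]; ring
  rcases eq_or_ne l j with rfl | hj
  · simp [hi]; ring
  · simp [hi, hj, Equiv.swap_apply_of_ne_of_ne hi hj]; ring

theorem permEnd_divDiff (σ : Equiv.Perm (Fin M)) (i j : Fin M) :
    permEnd F σ * divDiff F i j = divDiff F (σ i) (σ j) * permEnd F σ := by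
  rcases eq_or_ne i j with rfl | h
  · simp [divDiff]
  refine LinearMap.ext fun f => ?_
  rw [Module.End.mul_apply, Module.End.mul_apply, eq_comm, divDiff_eq_iff (σ.injective.ne h),
    ← permEnd_X, ← permEnd_X, ← map_sub, ← permEnd_map_mul, X_sub_X_mul_divDiff h, map_sub,
    ← Module.End.mul_apply, ← Module.End.mul_apply, permEnd_mul, permEnd_mul,
    Equiv.swap_apply_apply]
  simp [mul_assoc]

/-- Multiplication by the variable `z_i`. -/
noncomputable def mulX (F : Type*) [Field F] {M : ℕ} (i : Fin M) :
    Module.End F (MvPolynomial (Fin M) F) :=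
  LinearMap.mulLeft F (X i)

theorem mulX_apply (i : Fin M) (f : MvPolynomial (Fin M) F) : mulX F i f = X i * f := rfl

theorem mulX_comm (i j : Fin M) : mulX F i * mulX F j = mulX F j * mulX F i := by
  refine LinearMap.ext fun f => ?_
  simp [mulX_apply, mul_left_comm]

theorem permEnd_mulX (σ : Equiv.Perm (Fin M)) (i : Fin M) :
    permEnd F σ * mulX F i = mulX F (σ i) * permEnd F σ := by
  refine LinearMap.ext fun f => ?_
  simp [mulX_apply, permEnd_map_mul, permEnd_X]

theorem permEnd_pderiv (σ : Equiv.Perm (Fin M)) (i : Fin M) (f : MvPolynomial (Fin M) F) :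
    permEnd F σ (pderiv i f) = pderiv (σ i) (permEnd F σ f) := by
  rw [permEnd_apply, permEnd_apply, pderiv_rename σ.injective]

/-- The Dunkl operator `∇_i` as a linear endomorphism. -/
noncomputable def nablaEnd (β : F) (i : Fin M) : Module.End F (MvPolynomial (Fin M) F) :=
  (pderiv i).toLinearMap + β • ∑ j, divDiff F i j

theorem nablaEnd_apply (β : F) (i : Fin M) (f : MvPolynomial (Fin M) F) :
    nablaEnd β i f = nabla β i f := by
  have h0 : divDiff F i i = 0 := by simp [divDiff]
  have h : ∀ j ∈ univ.erase i, divExact (X i - X j) (f - Kswap i j f) = divDiff F i j f :=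
    fun j hj => (divDiff_apply (Finset.ne_of_mem_erase hj).symm f).symm
  rw [nabla, Finset.sum_congr rfl h, nablaEnd, ← Finset.add_sum_erase _ _ (mem_univ i), h0,
    zero_add]
  simp [LinearMap.sum_apply]

theorem permEnd_nablaEnd (β : F) (σ : Equiv.Perm (Fin M)) (i : Fin M) :
    permEnd F σ * nablaEnd β i = nablaEnd β (σ i) * permEnd F σ := by
  have h : permEnd F σ * (pderiv i).toLinearMap = (pderiv (σ i)).toLinearMap * permEnd F σ := by
    refine LinearMap.ext fun f => ?_
    exact permEnd_pderiv σ i f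
  rw [nablaEnd, nablaEnd, mul_add, add_mul, h, mul_smul_comm, smul_mul_assoc, Finset.mul_sum,
    Finset.sum_mul]
  simp_rw [permEnd_divDiff]
  rw [Equiv.sum_comp σ (fun j => divDiff F (σ i) j * permEnd F σ)]

theorem nablaEnd_mulX_of_ne (β : F) {i l : Fin M} (h : l ≠ i) :
    nablaEnd β i * mulX F l = mulX F l * nablaEnd β i - β • swapEnd F i l := by
  refine LinearMap.ext fun f => ?_
  have hs : ∀ j, divDiff F i j (X l * f)
      = X l * divDiff F i j f - (if l = j then 1 else 0) * swapEnd F i j f := by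
    intro j
    rcases eq_or_ne i j with rfl | hj
    · simp [divDiff, h]
    · rw [divDiff_X_mul hj, if_neg h]
      ring
  simp only [nablaEnd, Module.End.mul_apply, LinearMap.add_apply, LinearMap.smul_apply,
    LinearMap.sub_apply, LinearMap.sum_apply, mulX_apply, hs, Finset.sum_sub_distrib]
  simp [pderiv_X_of_ne h, smul_sub, Finset.mul_sum, mul_add]
  abel

theorem nablaEnd_mulX_self (β : F) (i : Fin M) :
    nablaEnd β i * mulX F i
      = mulX F i * nablaEnd β i + 1 + β • ∑ j ∈ univ.erase i, swapEnd F i j := by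
  refine LinearMap.ext fun f => ?_
  have hs : ∀ j, divDiff F i j (X i * f)
      = X i * divDiff F i j f + if j ∈ univ.erase i then swapEnd F i j f else 0 := by
    intro j
    rcases eq_or_ne i j with rfl | hj
    · simp [divDiff]
    · rw [divDiff_X_mul hj]
      simp [hj, hj.symm]
  simp only [nablaEnd, Module.End.mul_apply, LinearMap.add_apply, LinearMap.smul_apply,
    LinearMap.sum_apply, mulX_apply, hs, Finset.sum_add_distrib,
    Finset.sum_ite_mem, Finset.univ_inter]
  simp [smul_add, Finset.mul_sum, mul_add]
  abel

theorem nablaEnd_one (β : F) (i : Fin M) : nablaEnd β i 1 = 0 := by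
  have h : ∀ j, divDiff F i j 1 = 0 := by
    intro j
    rcases eq_or_ne i j with rfl | hj
    · simp [divDiff]
    · rw [divDiff_eq_iff hj]
      simp [permEnd_apply]
  simp [nablaEnd, h]

theorem end_eq_zero_of_commute_mulX {C : Module.End F (MvPolynomial (Fin M) F)} (h1 : C 1 = 0)
    (hX : ∀ l, C * mulX F l = mulX F l * C) : C = 0 := by
  refine LinearMap.ext fun f => ?_
  induction f using MvPolynomial.induction_on with
  | C a => rw [← mul_one (MvPolynomial.C a), ← smul_eq_C_mul, map_smul, h1]; simp
  | add p q hp hq => rw [map_add, hp, hq]; simp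
  | mul_X p n hp =>
    have := congrArg (fun A => A p) (hX n)
    simp only [Module.End.mul_apply, mulX_apply, hp] at this
    rw [mul_comm, this]
    simp

theorem nablaEnd_comm (β : F) (i j : Fin M) :
    nablaEnd β i * nablaEnd β j = nablaEnd β j * nablaEnd β i := by
  rcases eq_or_ne i j with rfl | hij
  · rfl
  have hK : ∀ a b c : Fin M, a ≠ b → a ≠ c →
      swapEnd F b c * nablaEnd β a = nablaEnd β a * swapEnd F b c := by
    intro a b c hab hac
    rw [permEnd_nablaEnd, Equiv.swap_apply_of_ne_of_ne hab hac]
  have hK' : ∀ a b : Fin M, swapEnd F a b * nablaEnd β a = nablaEnd β b * swapEnd F a b := by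
    intro a b
    rw [permEnd_nablaEnd, Equiv.swap_apply_left]
  have key : ∀ a b : Fin M, a ≠ b →
      (nablaEnd β a * nablaEnd β b - nablaEnd β b * nablaEnd β a) * mulX F a
        = mulX F a * (nablaEnd β a * nablaEnd β b - nablaEnd β b * nablaEnd β a) := by
    intro a b hab
    have hb := nablaEnd_mulX_of_ne β hab
    have ha := nablaEnd_mulX_self β a
    have hsum : (∑ m ∈ univ.erase a, swapEnd F a m) * nablaEnd β b
        - nablaEnd β b * ∑ m ∈ univ.erase a, swapEnd F a m
        = swapEnd F a b * nablaEnd β b - nablaEnd β b * swapEnd F a b := by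
      have hb' : b ∈ univ.erase a := by simp [hab.symm]
      rw [← Finset.add_sum_erase _ _ hb', add_mul, mul_add, Finset.sum_mul, Finset.mul_sum,
        Finset.sum_congr rfl fun m hm => hK b a m hab.symm (Finset.ne_of_mem_erase hm).symm]
      abel
    have h1 := hK' a b
    have h2 := hK' b a
    rw [swapEnd_comm b a] at h2 hb
    set A := nablaEnd β a
    set B := nablaEnd β b
    set S := ∑ m ∈ univ.erase a, swapEnd F a m
    set K := swapEnd F a b
    set x := mulX F a
    calc (A * B - B * A) * x = A * (B * x) - B * (A * x) := by simp only [sub_mul, mul_assoc]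
      _ = A * (x * B - β • K) - B * (x * A + 1 + β • S) := by rw [hb, ha]
      _ = A * x * B - B * x * A - β • (A * K) - B - β • (B * S) := by
        simp only [mul_sub, mul_add, mul_smul_comm, mul_one, mul_assoc]
        abel
      _ = x * (A * B - B * A) + β • ((S * B - B * S) - (K * B - B * K))
          + β • (K * A - B * K) + β • (K * B - A * K) := by
        rw [hb, ha]
        simp only [mul_sub, sub_mul, add_mul, smul_mul_assoc, one_mul, mul_assoc, smul_sub]
        abel
      _ = _ := by rw [hsum, h1, h2]; simp
  refine sub_eq_zero.mp (end_eq_zero_of_commute_mulX ?_ fun l => ?_)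
  · simp [nablaEnd_one]
  rcases eq_or_ne l i with rfl | hi
  · exact key l j hij
  rcases eq_or_ne l j with rfl | hj
  · have := key l i hij.symm
    simp only [sub_mul, mul_sub] at this ⊢
    simpa only [neg_sub] using congrArg Neg.neg this
  have h1 := nablaEnd_mulX_of_ne β hi
  have h2 := nablaEnd_mulX_of_ne β hj
  have h3 := hK j i l hij.symm hj.symm
  have h4 := hK i j l hij hi.symm
  rw [sub_mul, mul_assoc, mul_assoc, h1, h2, mul_sub, mul_sub, ← mul_assoc, ← mul_assoc, h1, h2,
    sub_mul, sub_mul, mul_smul_comm, mul_smul_comm, smul_mul_assoc, smul_mul_assoc, h3, h4]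
  simp only [mul_sub, mul_assoc]
  abel

/-- The operator `D_i = z_i ∇_i` as a linear endomorphism. -/
noncomputable def dunklEnd (β : F) (i : Fin M) : Module.End F (MvPolynomial (Fin M) F) :=
  mulX F i * nablaEnd β i

theorem dunklEnd_apply (β : F) (i : Fin M) (f : MvPolynomial (Fin M) F) :
    dunklEnd β i f = Dop β i f := by
  rw [dunklEnd, Module.End.mul_apply, nablaEnd_apply, mulX_apply, Dop]

theorem permEnd_dunklEnd (β : F) (σ : Equiv.Perm (Fin M)) (i : Fin M) :
    permEnd F σ * dunklEnd β i = dunklEnd β (σ i) * permEnd F σ := by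
  rw [dunklEnd, dunklEnd, ← mul_assoc, permEnd_mulX, mul_assoc, permEnd_nablaEnd, mul_assoc]

theorem swapEnd_dunklEnd_of_ne (β : F) {a i j : Fin M} (hi : a ≠ i) (hj : a ≠ j) :
    swapEnd F i j * dunklEnd β a = dunklEnd β a * swapEnd F i j := by
  rw [permEnd_dunklEnd, Equiv.swap_apply_of_ne_of_ne hi hj]

theorem dunklEnd_mulX_of_ne (β : F) {i j : Fin M} (h : j ≠ i) :
    dunklEnd β i * mulX F j = mulX F j * dunklEnd β i - β • (swapEnd F i j * mulX F j) := by
  rw [dunklEnd, mul_assoc, nablaEnd_mulX_of_ne β h, permEnd_mulX, Equiv.swap_apply_right, mul_sub,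
    ← mul_assoc, mulX_comm, mul_assoc, mul_smul_comm]

theorem dunklEnd_mul_sub (β : F) {i j : Fin M} (h : i ≠ j) :
    dunklEnd β i * dunklEnd β j - dunklEnd β j * dunklEnd β i
      = β • (dunklEnd β j * swapEnd F i j - dunklEnd β i * swapEnd F i j) := by
  have aux : ∀ i j : Fin M, i ≠ j → dunklEnd β i * dunklEnd β j
      = mulX F i * mulX F j * (nablaEnd β i * nablaEnd β j)
        - β • (dunklEnd β i * swapEnd F i j) := by
    intro i j h
    rw [dunklEnd, dunklEnd, mul_assoc, ← mul_assoc (nablaEnd β i), nablaEnd_mulX_of_ne β h.symm,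
      sub_mul, smul_mul_assoc, permEnd_nablaEnd, Equiv.swap_apply_right, mul_sub, mul_smul_comm]
    simp only [mul_assoc]
  rw [aux i j h, aux j i h.symm, mulX_comm j i, nablaEnd_comm β j i, swapEnd_comm j i, smul_sub]
  abel

theorem swapEnd_mul_swapEnd {a b m : Fin M} (hab : a ≠ b) (hma : m ≠ a) :
    swapEnd F a m * swapEnd F b m = swapEnd F b m * swapEnd F a b := by
  rw [swapEnd, swapEnd, swapEnd, permEnd_mul, permEnd_mul]
  congr 1
  have h := Equiv.mul_swap_eq_swap_mul (Equiv.swap b m) a b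
  rw [h, Equiv.swap_apply_left, Equiv.swap_apply_of_ne_of_ne hab hma.symm]

/-- The sum of the exchange operators `K_{aj}` for `j` running through a list. -/
noncomputable def swapSum (F : Type*) [Field F] {M : ℕ} (a : Fin M) (t : List (Fin M)) :
    Module.End F (MvPolynomial (Fin M) F) :=
  (t.map fun j => swapEnd F a j).sum

theorem swapSum_cons (a j : Fin M) (t : List (Fin M)) :
    swapSum F a (j :: t) = swapEnd F a j + swapSum F a t := by
  simp [swapSum]

theorem swapSum_append (a : Fin M) (s t : List (Fin M)) :
    swapSum F a (s ++ t) = swapSum F a s + swapSum F a t := by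
  simp [swapSum]

theorem swapSum_perm (a : Fin M) {s t : List (Fin M)} (h : s.Perm t) :
    swapSum F a s = swapSum F a t :=
  (h.map _).sum_eq

theorem permEnd_swapSum (σ : Equiv.Perm (Fin M)) (a : Fin M) (t : List (Fin M)) :
    permEnd F σ * swapSum F a t = swapSum F (σ a) (t.map σ) * permEnd F σ := by
  induction t with
  | nil => simp [swapSum]
  | cons m t ih =>
    rw [List.map_cons, swapSum_cons, swapSum_cons, mul_add, add_mul, ih, permEnd_mul, permEnd_mul,
      Equiv.swap_apply_apply]
    simp [mul_assoc]

theorem List.map_swap_eq_self {a b : Fin M} {t : List (Fin M)} (ha : a ∉ t) (hb : b ∉ t) :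
    t.map (Equiv.swap a b) = t := by
  conv_rhs => rw [← List.map_id t]
  refine List.map_congr_left fun m hm => ?_
  rw [Equiv.swap_apply_of_ne_of_ne (by rintro rfl; exact ha hm) (by rintro rfl; exact hb hm), id]

theorem swapSum_mul_sub {a b : Fin M} (hab : a ≠ b) {t : List (Fin M)} (ha : a ∉ t) (hb : b ∉ t)
    (ht : t.Nodup) :
    swapSum F b t * swapSum F a t - swapSum F a t * swapSum F b t
      = swapSum F a t * swapEnd F a b - swapSum F b t * swapEnd F a b := by
  induction t with
  | nil => simp [swapSum]
  | cons m t ih =>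
    rw [List.mem_cons, not_or] at ha hb
    rw [List.nodup_cons] at ht
    have h1 : swapEnd F b m * swapSum F a t = swapSum F a t * swapEnd F b m := by
      rw [permEnd_swapSum, Equiv.swap_apply_of_ne_of_ne hab ha.1,
        List.map_swap_eq_self hb.2 ht.1]
    have h2 : swapEnd F a m * swapSum F b t = swapSum F b t * swapEnd F a m := by
      rw [permEnd_swapSum, Equiv.swap_apply_of_ne_of_ne hab.symm hb.1,
        List.map_swap_eq_self ha.2 ht.1]
    have h3 : swapEnd F a m * swapEnd F b m = swapEnd F b m * swapEnd F a b :=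
      swapEnd_mul_swapEnd hab (Ne.symm ha.1)
    have h4 : swapEnd F b m * swapEnd F a m = swapEnd F a m * swapEnd F a b := by
      rw [swapEnd_mul_swapEnd hab.symm (Ne.symm hb.1), swapEnd_comm b a]
    have h5 := ih ha.2 hb.2 ht.2
    rw [swapSum_cons, swapSum_cons]
    calc _ = (swapEnd F b m * swapEnd F a m - swapEnd F a m * swapEnd F b m)
          + (swapEnd F b m * swapSum F a t - swapSum F a t * swapEnd F b m)
          + (swapSum F b t * swapEnd F a m - swapEnd F a m * swapSum F b t)
          + (swapSum F b t * swapSum F a t - swapSum F a t * swapSum F b t) := by noncomm_ring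
      _ = _ := by
        rw [h1, h2, h3, h4, h5]
        noncomm_ring

/-- The factor `D_a + c + β ∑_{j ∈ t} K_{aj}`. -/
noncomputable def cherednik (β c : F) (a : Fin M) (t : List (Fin M)) :
    Module.End F (MvPolynomial (Fin M) F) :=
  dunklEnd β a + c • 1 + β • swapSum F a t

theorem permEnd_cherednik (β c : F) (σ : Equiv.Perm (Fin M)) (a : Fin M) (t : List (Fin M)) :
    permEnd F σ * cherednik β c a t = cherednik β c (σ a) (t.map σ) * permEnd F σ := by
  simp only [cherednik, mul_add, add_mul, mul_smul_comm, smul_mul_assoc, permEnd_swapSum,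
    permEnd_dunklEnd, mul_one, one_mul]

theorem dunklEnd_swapSum (β : F) {a b : Fin M} (hab : a ≠ b) {t : List (Fin M)} (hb : b ∉ t) :
    swapSum F a t * dunklEnd β b = dunklEnd β b * swapSum F a t := by
  induction t with
  | nil => simp [swapSum]
  | cons m t ih =>
    rw [List.mem_cons, not_or] at hb
    rw [swapSum_cons, add_mul, mul_add, ih hb.2, swapEnd_dunklEnd_of_ne β hab.symm hb.1]

theorem cherednik_comm (β c : F) {a b : Fin M} (hab : a ≠ b) {t : List (Fin M)} (ha : a ∉ t)
    (hb : b ∉ t) (ht : t.Nodup) :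
    cherednik β c b t * cherednik β c a (b :: t)
      = cherednik β c a t * cherednik β c b (a :: t) := by
  have h1 := dunklEnd_mul_sub β hab
  have h2 := dunklEnd_swapSum β hab hb
  have h3 := dunklEnd_swapSum β hab.symm ha
  have h4 := swapSum_mul_sub (F := F) hab ha hb ht
  simp only [cherednik, swapSum_cons, swapEnd_comm b a]
  set A := dunklEnd β a
  set B := dunklEnd β b
  set S := swapSum F a t
  set T := swapSum F b t
  set K := swapEnd F a b
  rw [← sub_eq_zero]
  calc _ = -(A * B - B * A) + β • (B * K - A * K) + β • (B * S - S * B)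
        + β • (T * A - A * T) + (β * β) • ((T * S - S * T) - (S * K - T * K)) := by
        simp only [mul_add, add_mul, smul_add, smul_sub, mul_smul_comm, smul_mul_assoc,
          mul_one, one_mul, smul_smul, mul_comm c β]
        abel
    _ = 0 := by rw [h1, h2, h3, h4]; simp

/-- The ordered product of the factors `D_a + c + β ∑_{j} K_{aj}`, where `j` runs through the
entries following `a` in the list; the head of the list is applied first. -/
noncomputable def cherednikProd (β c : F) : List (Fin M) → Module.End F (MvPolynomial (Fin M) F)
  | [] => 1
  | a :: t => cherednikProd β c t * cherednik β c a t

theorem cherednikProd_perm (β c : F) {s t : List (Fin M)} (h : s.Perm t) (hs : s.Nodup) :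
    cherednikProd β c s = cherednikProd β c t := by
  induction h with
  | nil => rfl
  | cons a h ih =>
    rw [cherednikProd, cherednikProd, ih (List.nodup_cons.mp hs).2, cherednik, cherednik,
      swapSum_perm a h]
  | swap a b t =>
    simp only [List.nodup_cons, List.mem_cons, not_or] at hs
    rw [cherednikProd, cherednikProd, cherednikProd, cherednikProd, mul_assoc, mul_assoc,
      cherednik_comm β c (Ne.symm hs.1.1) hs.2.1 hs.1.2 hs.2.2]
  | trans h1 h2 ih1 ih2 => rw [ih1 hs, ih2 (h1.nodup_iff.mp hs)]

theorem permEnd_cherednikProd (β c : F) (σ : Equiv.Perm (Fin M)) (t : List (Fin M)) :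
    permEnd F σ * cherednikProd β c t = cherednikProd β c (t.map σ) * permEnd F σ := by
  induction t with
  | nil => simp [cherednikProd]
  | cons a t ih =>
    rw [List.map_cons, cherednikProd, cherednikProd, ← mul_assoc, ih, mul_assoc,
      permEnd_cherednik, mul_assoc]

theorem swapSum_apply_of_fixed {a : Fin M} {t : List (Fin M)} {f : MvPolynomial (Fin M) F}
    (h : ∀ j ∈ t, swapEnd F a j f = f) : swapSum F a t f = (t.length : F) • f := by
  induction t with
  | nil => simp [swapSum]
  | cons m t ih =>
    rw [swapSum_cons, LinearMap.add_apply, h m (by simp),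
      ih fun j hj => h j (List.mem_cons_of_mem _ hj)]
    simp [add_smul, add_comm]

/-- `Dlist` as a linear endomorphism. -/
noncomputable def dlistEnd (β : F) : ℕ → List (Fin M) → Module.End F (MvPolynomial (Fin M) F)
  | _, [] => 1
  | k, j :: t => (dunklEnd β j + ((k : F) * β) • 1) * dlistEnd β (k + 1) t

theorem dlistEnd_apply (β : F) (k : ℕ) (l : List (Fin M)) (f : MvPolynomial (Fin M) F) :
    dlistEnd β k l f = Dlist β k l f := by
  induction l generalizing k with
  | nil => rfl
  | cons j t ih =>
    rw [dlistEnd, Dlist, Module.End.mul_apply, ih, LinearMap.add_apply, dunklEnd_apply]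
    rfl

theorem dlistEnd_concat (β : F) (k : ℕ) (l : List (Fin M)) (a : Fin M) :
    dlistEnd β k (l ++ [a])
      = dlistEnd β k l * (dunklEnd β a + (((k + l.length : ℕ) : F) * β) • 1) := by
  induction l generalizing k with
  | nil => simp [dlistEnd]
  | cons j t ih =>
    rw [List.cons_append, dlistEnd, dlistEnd, ih, mul_assoc, List.length_cons]
    congr 5
    push_cast
    ring

theorem dlistEnd_reverse_apply (β : F) (k : ℕ) {t : List (Fin M)} (ht : t.Nodup)
    {f : MvPolynomial (Fin M) F} (hf : ∀ i ∈ t, ∀ j ∈ t, swapEnd F i j f = f) :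
    dlistEnd β k t.reverse f = cherednikProd β (k * β) t f := by
  induction t generalizing f with
  | nil => rfl
  | cons a t ih =>
    rw [List.nodup_cons] at ht
    have hfa : cherednik β (k * β) a t f
        = (dunklEnd β a + (((k + t.length : ℕ) : F) * β) • 1) f := by
      have := swapSum_apply_of_fixed (a := a) (t := t) (f := f)
        fun j hj => hf a (by simp) j (List.mem_cons_of_mem _ hj)
      simp only [cherednik, LinearMap.add_apply, LinearMap.smul_apply, this, Module.End.one_apply]
      rw [add_assoc, smul_smul, ← add_smul]
      push_cast
      ring_nf
    rw [List.reverse_cons, dlistEnd_concat, List.length_reverse, cherednikProd,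
      Module.End.mul_apply, Module.End.mul_apply, hfa, ih ht.2]
    intro i hi j hj
    have hai : a ≠ i := by rintro rfl; exact ht.1 hi
    have haj : a ≠ j := by rintro rfl; exact ht.1 hj
    have h1 := hf i (List.mem_cons_of_mem _ hi) j (List.mem_cons_of_mem _ hj)
    rw [LinearMap.add_apply, map_add, ← Module.End.mul_apply, swapEnd_dunklEnd_of_ne β hai haj,
      Module.End.mul_apply, h1, LinearMap.smul_apply, map_smul, Module.End.one_apply, h1]

theorem SymmOn.swapEnd_apply {S : Finset (Fin M)} {f : MvPolynomial (Fin M) F}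
    (hf : SymmOn S f) {i j : Fin M} (hi : i ∈ S) (hj : j ∈ S) : swapEnd F i j f = f :=
  hf i hi j hj

theorem Dlist_eq_cherednikProd (β : F) (k : ℕ) {S : Finset (Fin M)} {l t : List (Fin M)}
    (hl : l.Nodup) (hlS : ∀ i ∈ l, i ∈ S) (hlt : l.Perm t) {f : MvPolynomial (Fin M) F}
    (hf : SymmOn S f) : Dlist β k l f = cherednikProd β (k * β) t f := by
  have hl' : l.reverse.Nodup := List.nodup_reverse.mpr hl
  rw [← dlistEnd_apply, ← List.reverse_reverse l, dlistEnd_reverse_apply β k hl' fun i hi j hj =>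
    hf.swapEnd_apply (hlS i (List.mem_reverse.mp hi)) (hlS j (List.mem_reverse.mp hj)),
    cherednikProd_perm β _ ((List.reverse_perm l).trans hlt) hl']

theorem DJ_eq_cherednikProd (β : F) (k : ℕ) {S J : Finset (Fin M)} (hJ : J ⊆ S)
    {t : List (Fin M)} (ht : t.Nodup) (htJ : t.toFinset = J) {f : MvPolynomial (Fin M) F}
    (hf : SymmOn S f) : DJ β k J f = cherednikProd β (k * β) t f := by
  refine Dlist_eq_cherednikProd β k (Finset.sort_nodup _ _) (fun i hi => hJ (by simpa using hi))
    ?_ hf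
  refine (List.perm_ext_iff_of_nodup (Finset.sort_nodup _ _) ht).mpr fun i => ?_
  rw [Finset.mem_sort, ← htJ, List.mem_toFinset]

theorem swapEnd_DJ (β : F) (k : ℕ) {S J : Finset (Fin M)} (hJ : J ⊆ S)
    {f : MvPolynomial (Fin M) F} (hf : SymmOn S f) {i j : Fin M} (hi : i ∈ S) (hj : j ∈ S) :
    swapEnd F i j (DJ β k J f) = DJ β k (J.image (Equiv.swap i j)) f := by
  have hJ' : J.image (Equiv.swap i j) ⊆ S := by
    intro x hx
    obtain ⟨y, hy, rfl⟩ := Finset.mem_image.mp hx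
    rw [Equiv.swap_apply_def]
    split_ifs
    exacts [hj, hi, hJ hy]
  rw [DJ_eq_cherednikProd β k hJ J.nodup_toList (Finset.toList_toFinset J) hf,
    DJ_eq_cherednikProd β k hJ' (t := J.toList.map (Equiv.swap i j))
      (J.nodup_toList.map (Equiv.injective _)) (by ext; simp) hf,
    ← Module.End.mul_apply, permEnd_cherednikProd, Module.End.mul_apply,
    hf.swapEnd_apply hi hj]

theorem image_swap_of_notMem {J : Finset (Fin M)} {a b : Fin M} (ha : a ∉ J) (hb : b ∉ J) :
    J.image (Equiv.swap a b) = J := by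
  conv_rhs => rw [← Finset.image_id (s := J)]
  refine Finset.image_congr fun m hm => ?_
  rw [Equiv.swap_apply_of_ne_of_ne (by rintro rfl; exact ha hm) (by rintro rfl; exact hb hm), id]

theorem image_swap_of_notMem_of_mem {J : Finset (Fin M)} {a b : Fin M} (ha : a ∉ J)
    (hb : b ∈ J) : J.image (Equiv.swap a b) = insert a (J.erase b) := by
  conv_lhs => rw [← Finset.insert_erase hb]
  rw [Finset.image_insert, Equiv.swap_apply_right,
    image_swap_of_notMem (fun h => ha (Finset.mem_of_mem_erase h)) (Finset.notMem_erase b J)]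

/-- If `D_{k,L₀} f = 0` for one subset `L₀` of the set in which `f` is symmetric, then
`D_{k,L} f = 0` for every subset `L` of the same size. -/
theorem DJ_eq_zero_of_card_eq (β : F) (k : ℕ) {S L₀ L : Finset (Fin M)} (hL₀ : L₀ ⊆ S)
    (hL : L ⊆ S) (hcard : L.card = L₀.card) {f : MvPolynomial (Fin M) F} (hf : SymmOn S f)
    (h0 : DJ β k L₀ f = 0) : DJ β k L f = 0 := by
  induction hn : (L \ L₀).card using Nat.strong_induction_on generalizing L with
  | _ n ih =>
    by_cases hsub : L ⊆ L₀
    · rwa [Finset.eq_of_subset_of_card_le hsub hcard.ge]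
    obtain ⟨a, haL, ha⟩ := Finset.not_subset.mp hsub
    have hsub' : ¬ L₀ ⊆ L := fun h => ha (Finset.eq_of_subset_of_card_le h hcard.le ▸ haL)
    obtain ⟨b, hb, hbL⟩ := Finset.not_subset.mp hsub'
    have himg := image_swap_of_notMem_of_mem hbL haL
    have hsw := swapEnd_DJ β k hL hf (hL₀ hb) (hL haL)
    have hL' : insert b (L.erase a) ⊆ S :=
      Finset.insert_subset (hL₀ hb) ((Finset.erase_subset _ _).trans hL)
    have hc' : (insert b (L.erase a)).card = L₀.card := by
      rw [← himg, Finset.card_image_of_injective _ (Equiv.injective _), hcard]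
    have hlt : (insert b (L.erase a) \ L₀).card < n := by
      rw [← hn]
      refine Finset.card_lt_card ⟨fun x hx => ?_, fun h => ?_⟩
      · simp only [Finset.mem_sdiff, Finset.mem_insert, Finset.mem_erase] at hx ⊢
        rcases hx.1 with rfl | h
        · exact absurd hb hx.2
        · exact ⟨h.2, hx.2⟩
      · have := h (Finset.mem_sdiff.mpr ⟨haL, ha⟩)
        simp only [Finset.mem_sdiff, Finset.mem_insert, Finset.mem_erase] at this
        rcases this.1 with rfl | h'
        · exact hbL haL
        · exact h'.1 rfl
    rw [himg, ih _ hlt hL' hc' rfl] at hsw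
    have hinj : Function.Injective (swapEnd F b a) := rename_injective _ (Equiv.injective _)
    exact hinj (by rw [hsw, map_zero])

theorem permEnd_zJ (σ : Equiv.Perm (Fin M)) (J : Finset (Fin M)) :
    permEnd F σ (zJ J) = zJ (J.image σ) := by
  rw [zJ, zJ, Finset.prod_image σ.injective.injOn, permEnd_apply, map_prod]
  simp

theorem dunklEnd_zJ_mul (β : F) {a : Fin M} {J : Finset (Fin M)} (ha : a ∉ J)
    (h : MvPolynomial (Fin M) F) :
    dunklEnd β a (zJ J * h)
      = zJ J * dunklEnd β a h - β • ∑ j ∈ J, swapEnd F a j (zJ J * h) := by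
  induction J using Finset.induction_on with
  | empty => simp [zJ]
  | insert m J hm ih =>
    rw [Finset.mem_insert, not_or] at ha
    have hz : (zJ (insert m J) : MvPolynomial (Fin M) F) = X m * zJ J := by
      rw [zJ, Finset.prod_insert hm, zJ]
    have hD := congrArg (fun A => A (zJ J * h)) (dunklEnd_mulX_of_ne β (Ne.symm ha.1))
    simp only [Module.End.mul_apply, mulX_apply, LinearMap.sub_apply, LinearMap.smul_apply] at hD
    have hs : ∀ j ∈ J, swapEnd F a j (X m * (zJ J * h)) = X m * swapEnd F a j (zJ J * h) := by
      intro j hj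
      rw [permEnd_map_mul, permEnd_X, Equiv.swap_apply_of_ne_of_ne (Ne.symm ha.1)]
      rintro rfl
      exact hm hj
    rw [hz, mul_assoc, hD, ih ha.2, Finset.sum_insert hm, Finset.sum_congr rfl hs,
      ← Finset.mul_sum, mul_sub, mul_smul_comm, smul_add, mul_assoc]
    abel

/-- The term `z_J D_{1,J} f` of the creation operator. -/
noncomputable def bplusTerm (β : F) (f : MvPolynomial (Fin M) F) (J : Finset (Fin M)) :
    MvPolynomial (Fin M) F :=
  zJ J * DJ β 1 J f

theorem swapEnd_bplusTerm (β : F) {S J : Finset (Fin M)} (hJ : J ⊆ S)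
    {f : MvPolynomial (Fin M) F} (hf : SymmOn S f) {i j : Fin M} (hi : i ∈ S) (hj : j ∈ S) :
    swapEnd F i j (bplusTerm β f J) = bplusTerm β f (J.image (Equiv.swap i j)) := by
  rw [bplusTerm, permEnd_map_mul, permEnd_zJ, swapEnd_DJ β 1 hJ hf hi hj, bplusTerm]

theorem dunklEnd_bplusTerm (β : F) {S J : Finset (Fin M)} (hJ : J ⊆ S)
    {f : MvPolynomial (Fin M) F} (hf : SymmOn S f) {a : Fin M} (ha : a ∈ S) (haJ : a ∉ J)
    (h0 : DJ β 0 (insert a J) f = 0) :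
    dunklEnd β a (bplusTerm β f J) = -(β • ∑ j ∈ J, swapEnd F a j (bplusTerm β f J)) := by
  have hnd : (a :: J.sort (· ≤ ·)).Nodup :=
    List.nodup_cons.mpr ⟨by simpa using haJ, Finset.sort_nodup _ _⟩
  have hfac : dunklEnd β a (DJ β 1 J f) = DJ β 0 (insert a J) f := by
    rw [DJ_eq_cherednikProd β 0 (Finset.insert_subset ha hJ) hnd (by ext; simp) hf,
      ← Dlist_eq_cherednikProd β 0 hnd (S := S) (fun i hi => ?_) (List.Perm.refl _) hf, Dlist]
    · simp [DJ, dunklEnd_apply]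
    · rcases List.mem_cons.mp hi with rfl | hi
      exacts [ha, hJ (by simpa using hi)]
  rw [bplusTerm, dunklEnd_zJ_mul β haJ, hfac, h0, mul_zero, zero_sub]

theorem supported_le_of_single {ι : Type*} {s : Set (Finset ι)} {V : Submodule F (Finset ι →₀ F)}
    (h : ∀ R ∈ s, Finsupp.single R (1 : F) ∈ V) : Finsupp.supported F F s ≤ V := by
  rw [Finsupp.supported_eq_span_single, Submodule.span_le]
  rintro _ ⟨R, hR, rfl⟩
  exact h R hR

section Lowering

variable {ι : Type*} [DecidableEq ι]

/-- The operator `∑ ∂_i` on formal combinations of squarefree monomials, indexed by finite sets. -/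
noncomputable def lowering (F : Type*) [Field F] (ι : Type*) [DecidableEq ι] :
    Module.End F (Finset ι →₀ F) :=
  Finsupp.linearCombination F fun R => ∑ j ∈ R, Finsupp.single (R.erase j) 1

/-- Multiplication by the variable `x_a` on formal combinations of squarefree monomials. -/
noncomputable def raising (F : Type*) [Field F] {ι : Type*} [DecidableEq ι] (a : ι) :
    Module.End F (Finset ι →₀ F) :=
  Finsupp.lmapDomain F F (insert a)

theorem lowering_single (R : Finset ι) :
    lowering F ι (Finsupp.single R 1) = ∑ j ∈ R, Finsupp.single (R.erase j) 1 := by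
  simp [lowering]

theorem raising_single (a : ι) (R : Finset ι) :
    raising F a (Finsupp.single R 1) = Finsupp.single (insert a R) 1 := by
  simp [raising]

theorem lowering_mem_supported {a : ι} {y : Finset ι →₀ F}
    (hy : y ∈ Finsupp.supported F F {R : Finset ι | a ∉ R}) :
    lowering F ι y ∈ Finsupp.supported F F {R : Finset ι | a ∉ R} := by
  have : Finsupp.supported F F {R : Finset ι | a ∉ R}
      ≤ (Finsupp.supported F F {R : Finset ι | a ∉ R}).comap (lowering F ι) := by
    refine supported_le_of_single fun R hR => ?_
    rw [Submodule.mem_comap, lowering_single]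
    exact Submodule.sum_mem _ fun j _ =>
      Finsupp.single_mem_supported F 1 fun h => hR (Finset.mem_of_mem_erase h)
  exact this hy

theorem lowering_raising {a : ι} {y : Finset ι →₀ F}
    (hy : y ∈ Finsupp.supported F F {R : Finset ι | a ∉ R}) :
    lowering F ι (raising F a y) = y + raising F a (lowering F ι y) := by
  have : Finsupp.supported F F {R : Finset ι | a ∉ R}
      ≤ LinearMap.eqLocus (lowering F ι * raising F a) (1 + raising F a * lowering F ι) := by
    refine supported_le_of_single fun R hR => ?_
    rw [LinearMap.mem_eqLocus, LinearMap.add_apply, Module.End.mul_apply, Module.End.mul_apply,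
      Module.End.one_apply, raising_single, lowering_single, lowering_single, map_sum,
      Finset.sum_insert hR, Finset.erase_insert hR]
    refine congrArg _ (Finset.sum_congr rfl fun j hj => ?_)
    rw [raising_single, Finset.erase_insert_of_ne]
    rintro rfl
    exact hR hj
  exact this hy

theorem lowering_pow_apply {a : ι} {y : Finset ι →₀ F}
    (hy : y ∈ Finsupp.supported F F {R : Finset ι | a ∉ R}) (c : F) (n : ℕ) :
    (lowering F ι ^ n) (c • y - raising F a (lowering F ι y))
      = (c - n) • (lowering F ι ^ n) y - raising F a ((lowering F ι ^ (n + 1)) y) := by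
  have hmem : ∀ n, (lowering F ι ^ n) y ∈ Finsupp.supported F F {R : Finset ι | a ∉ R} := by
    intro n
    induction n with
    | zero => exact hy
    | succ n ih =>
      rw [pow_succ', Module.End.mul_apply]
      exact lowering_mem_supported ih
  induction n with
  | zero => simp
  | succ n ih =>
    rw [pow_succ', Module.End.mul_apply, ih, map_sub, map_smul, lowering_raising (hmem (n + 1)),
      pow_succ' _ (n + 1), pow_succ' _ n]
    simp only [Module.End.mul_apply]
    push_cast
    simp only [sub_smul, add_smul, one_smul]
    abel

theorem lowering_pow_eq_zero {m : ℕ} {y : Finset ι →₀ F}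
    (hy : y ∈ Finsupp.supported F F {R : Finset ι | R.card ≤ m}) :
    (lowering F ι ^ (m + 1)) y = 0 := by
  induction m generalizing y with
  | zero =>
    have : Finsupp.supported F F {R : Finset ι | R.card ≤ 0} ≤ LinearMap.ker (lowering F ι) := by
      refine supported_le_of_single fun R hR => ?_
      rw [Set.mem_ofPred_eq, Nat.le_zero, Finset.card_eq_zero] at hR
      simp [lowering_single, hR]
    simpa using this hy
  | succ m ih =>
    rw [pow_succ, Module.End.mul_apply]
    refine ih ?_
    have : Finsupp.supported F F {R : Finset ι | R.card ≤ m + 1}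
        ≤ (Finsupp.supported F F {R : Finset ι | R.card ≤ m}).comap (lowering F ι) := by
      refine supported_le_of_single fun R hR => ?_
      rw [Submodule.mem_comap, lowering_single]
      refine Submodule.sum_mem _ fun j hj => Finsupp.single_mem_supported F 1 ?_
      rw [Set.mem_ofPred_eq] at hR ⊢
      rw [Finset.card_erase_of_mem hj]
      omega
    exact this hy

end Lowering

/-- A family of polynomials indexed by the `k`-subsets `J` of `S`, permuted by the exchange
operators and satisfying `D_a g_J = -β ∑_{j ∈ J} K_{aj} g_J` for `a ∉ J`. -/
structure IsExchangeFamily (β : F) (S : Finset (Fin M)) (k : ℕ)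
    (g : Finset (Fin M) → MvPolynomial (Fin M) F) : Prop where
  swap_apply : ∀ J ⊆ S, J.card = k → ∀ i ∈ S, ∀ j ∈ S,
    swapEnd F i j (g J) = g (J.image (Equiv.swap i j))
  dunkl_apply : ∀ J ⊆ S, J.card = k → ∀ a ∈ S, a ∉ J →
    dunklEnd β a (g J) = -(β • ∑ j ∈ J, swapEnd F a j (g J))

namespace IsExchangeFamily

variable {β : F} {S : Finset (Fin M)} {k : ℕ} {g : Finset (Fin M) → MvPolynomial (Fin M) F}

theorem cherednik_single (hg : IsExchangeFamily β S k g) {a : Fin M} {p q : List (Fin M)}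
    (hnd : (a :: (p ++ q)).Nodup) (hS : ∀ i ∈ a :: (p ++ q), i ∈ S) {R : Finset (Fin M)}
    (hRS : R ⊆ S) (hR : Disjoint R (a :: (p ++ q)).toFinset) (hk : R.card + q.length = k) :
    cherednik β 0 a (p ++ q) (g (R ∪ q.toFinset))
      = β • ((p.length : F) • g (R ∪ q.toFinset)
          - ∑ j ∈ R, g (insert a (R.erase j) ∪ q.toFinset)) := by
  rw [List.nodup_cons, List.nodup_append] at hnd
  obtain ⟨ha, hp, hq, hpq⟩ := hnd
  rw [List.mem_append, not_or] at ha
  have hR' : ∀ x ∈ R, x ≠ a ∧ x ∉ p ∧ x ∉ q := by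
    intro x hx
    have := Finset.disjoint_left.mp hR hx
    simpa [not_or] using this
  have haR : a ∉ R := fun h => (hR' a h).1 rfl
  have haS : a ∈ S := hS a (by simp)
  have hdis : Disjoint R q.toFinset := by
    refine Finset.disjoint_left.mpr fun x hx hxq => (hR' x hx).2.2 (by simpa using hxq)
  have hJS : R ∪ q.toFinset ⊆ S :=
    Finset.union_subset hRS fun x hx => hS x (by simp [List.mem_toFinset.mp hx])
  have hJk : (R ∪ q.toFinset).card = k := by
    rw [Finset.card_union_of_disjoint hdis, List.toFinset_card_of_nodup hq, hk]
  have haJ : a ∉ R ∪ q.toFinset := by simp [haR, ha.2]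
  have hsp : swapSum F a p (g (R ∪ q.toFinset)) = (p.length : F) • g (R ∪ q.toFinset) := by
    refine swapSum_apply_of_fixed fun j hj => ?_
    have hjq : j ∉ q := fun h => hpq j hj j h rfl
    have hjR : j ∉ R := fun h => (hR' j h).2.1 hj
    rw [hg.swap_apply _ hJS hJk a haS j (hS j (by simp [hj])),
      image_swap_of_notMem haJ (by simp [hjq, hjR])]
  have hsq : swapSum F a q (g (R ∪ q.toFinset))
      = ∑ j ∈ q.toFinset, swapEnd F a j (g (R ∪ q.toFinset)) := by
    rw [← LinearMap.sum_apply, List.sum_toFinset _ hq, swapSum]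
  have hsR : ∑ j ∈ R, swapEnd F a j (g (R ∪ q.toFinset))
      = ∑ j ∈ R, g (insert a (R.erase j) ∪ q.toFinset) := by
    refine Finset.sum_congr rfl fun j hj => ?_
    rw [hg.swap_apply _ hJS hJk a haS j (hRS hj),
      image_swap_of_notMem_of_mem haJ (Finset.mem_union_left _ hj), Finset.insert_union,
      Finset.erase_union_distrib, Finset.erase_eq_of_notMem (s := q.toFinset)]
    simpa using (hR' j hj).2.2
  rw [cherednik, LinearMap.add_apply, LinearMap.add_apply, LinearMap.smul_apply,
    LinearMap.smul_apply, swapSum_append, LinearMap.add_apply, hsp, hsq,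
    hg.dunkl_apply _ hJS hJk a haS haJ, Finset.sum_union hdis, hsR, zero_smul]
  simp only [smul_add, smul_sub]
  abel

theorem cherednikProd_linearCombination (hg : IsExchangeFamily β S k g) {p q : List (Fin M)}
    (hnd : (p ++ q).Nodup) (hS : ∀ i ∈ p ++ q, i ∈ S) {y : Finset (Fin M) →₀ F}
    (hy : y ∈ Finsupp.supported F F
      {R : Finset (Fin M) | R ⊆ S ∧ Disjoint R (p ++ q).toFinset ∧ R.card + q.length = k})
    (h0 : (lowering F (Fin M) ^ p.length) y = 0) :
    cherednikProd β 0 (p ++ q)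
      (Finsupp.linearCombination F (fun R => g (R ∪ q.toFinset)) y) = 0 := by
  induction p generalizing y with
  | nil =>
    rw [List.length_nil, pow_zero, Module.End.one_apply] at h0
    simp [h0]
  | cons a p ih =>
    rw [List.cons_append] at hnd hS hy ⊢
    set G := Finsupp.linearCombination F (fun R => g (R ∪ q.toFinset)) with hG
    have haR : ∀ R : Finset (Fin M), Disjoint R (a :: (p ++ q)).toFinset → a ∉ R := fun R hR h =>
      Finset.disjoint_left.mp hR h (by simp)
    have hstep : cherednik β 0 a (p ++ q) (G y)
        = β • G ((p.length : F) • y - raising F a (lowering F (Fin M) y)) := by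
      have hle := supported_le_of_single (F := F)
        (s := {R : Finset (Fin M) | R ⊆ S ∧ Disjoint R (a :: (p ++ q)).toFinset ∧
          R.card + q.length = k})
        (V := LinearMap.eqLocus (cherednik β 0 a (p ++ q) ∘ₗ G)
          (β • G ∘ₗ ((p.length : F) • 1 - raising F a * lowering F (Fin M)))) (by
        rintro R ⟨hRS, hR, hk⟩
        have hGs : ∀ R, G (Finsupp.single R 1) = g (R ∪ q.toFinset) := by simp [hG]
        have hc := hg.cherednik_single hnd hS hRS hR hk
        rw [LinearMap.mem_eqLocus, LinearMap.comp_apply, LinearMap.smul_apply,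
          LinearMap.comp_apply, LinearMap.sub_apply, LinearMap.smul_apply, Module.End.one_apply,
          Module.End.mul_apply, lowering_single, map_sum, map_sub, map_smul, map_sum]
        simp only [raising_single, hGs]
        exact hc)
      exact hle hy
    have hyA : y ∈ Finsupp.supported F F {R : Finset (Fin M) | a ∉ R} :=
      Finsupp.supported_mono (fun R hR => haR R hR.2.1) hy
    rw [cherednikProd, Module.End.mul_apply, hstep, map_smul,
      ih (List.nodup_cons.mp hnd).2 (fun i hi => hS i (List.mem_cons_of_mem _ hi)) ?_ ?_,
      smul_zero]
    · have hle := supported_le_of_single (F := F)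
        (s := {R : Finset (Fin M) | R ⊆ S ∧ Disjoint R (a :: (p ++ q)).toFinset ∧
          R.card + q.length = k})
        (V := (Finsupp.supported F F {R : Finset (Fin M) | R ⊆ S ∧
          Disjoint R (p ++ q).toFinset ∧ R.card + q.length = k}).comap
            ((p.length : F) • 1 - raising F a * lowering F (Fin M))) (by
        rintro R ⟨hRS, hR, hk⟩
        have hR' : Disjoint R (p ++ q).toFinset :=
          hR.mono_right fun x hx => by
            rw [List.mem_toFinset] at hx ⊢
            exact List.mem_cons_of_mem _ hx
        rw [Submodule.mem_comap, LinearMap.sub_apply, LinearMap.smul_apply, Module.End.one_apply,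
          Module.End.mul_apply, lowering_single, map_sum]
        refine Submodule.sub_mem _ (Submodule.smul_mem _ _
          (Finsupp.single_mem_supported F 1 ⟨hRS, hR', hk⟩)) (Submodule.sum_mem _ fun j hj => ?_)
        rw [raising_single]
        refine Finsupp.single_mem_supported F 1 ⟨?_, ?_, ?_⟩
        · exact Finset.insert_subset (hS a (by simp)) ((Finset.erase_subset _ _).trans hRS)
        · rw [Finset.disjoint_insert_left, List.mem_toFinset]
          exact ⟨(List.nodup_cons.mp hnd).1, hR'.mono_left (Finset.erase_subset _ _)⟩
        · rw [Finset.card_insert_of_notMem fun h => haR R hR (Finset.mem_of_mem_erase h),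
            Finset.card_erase_add_one hj, hk])
      exact hle hy
    · rw [List.length_cons] at h0
      rw [lowering_pow_apply hyA, h0]
      simp

theorem cherednikProd_apply_eq_zero (hg : IsExchangeFamily β S k g) {L J : Finset (Fin M)}
    (hL : L ⊆ S) (hLk : L.card = k + 1) (hJ : J ⊆ S) (hJk : J.card = k) :
    cherednikProd β 0 L.toList (g J) = 0 := by
  set p := (L \ J).toList with hp
  set q := (L ∩ J).toList with hq
  have hmem : ∀ x, x ∈ p ++ q ↔ x ∈ L := by
    intro x
    simp only [hp, hq, List.mem_append, Finset.mem_toList, Finset.mem_sdiff, Finset.mem_inter]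
    tauto
  have hnd : (p ++ q).Nodup := by
    refine List.nodup_append.mpr ⟨Finset.nodup_toList _, Finset.nodup_toList _, ?_⟩
    intro x hx y hy hxy
    simp only [hp, hq, Finset.mem_toList, Finset.mem_sdiff, Finset.mem_inter] at hx hy
    exact hx.2 (hxy ▸ hy.2)
  have hperm : L.toList.Perm (p ++ q) :=
    (List.perm_ext_iff_of_nodup L.nodup_toList hnd).mpr fun x => by rw [hmem, Finset.mem_toList]
  have hJ' : (J \ L) ∪ q.toFinset = J := by
    rw [hq, Finset.toList_toFinset, Finset.inter_comm, Finset.sdiff_union_inter]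
  have hqc : q.length = (J ∩ L).card := by rw [hq, Finset.length_toList, Finset.inter_comm]
  have hpc : p.length = (L \ J).card := by rw [hp, Finset.length_toList]
  have hc1 := Finset.card_sdiff_add_card_inter J L
  have hc2 := Finset.card_sdiff_add_card_inter L J
  have hc3 : (L ∩ J).card = (J ∩ L).card := by rw [Finset.inter_comm]
  have key := hg.cherednikProd_linearCombination hnd (fun i hi => hL ((hmem i).mp hi))
    (y := Finsupp.single (J \ L) 1) ?_ ?_
  · rw [cherednikProd_perm β 0 hperm L.nodup_toList]
    simpa [hJ'] using key
  · refine Finsupp.single_mem_supported F 1 ⟨Finset.sdiff_subset.trans hJ, ?_, ?_⟩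
    · refine Finset.disjoint_left.mpr fun x hx hx' => (Finset.mem_sdiff.mp hx).2 ?_
      exact (hmem x).mp (List.mem_toFinset.mp hx')
    · omega
  · rw [show p.length = (J \ L).card + 1 by omega]
    exact lowering_pow_eq_zero (Finsupp.single_mem_supported F 1 (le_refl (J \ L).card))

end IsExchangeFamily

theorem symmOn_Bplus (β : F) (k : ℕ) {S : Finset (Fin M)} {f : MvPolynomial (Fin M) F}
    (hf : SymmOn S f) : SymmOn S (Bplus β k S f) := by
  intro i hi j hj
  change swapEnd F i j (∑ J ∈ S.powersetCard k, bplusTerm β f J)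
    = ∑ J ∈ S.powersetCard k, bplusTerm β f J
  have hS : ∀ x ∈ S, Equiv.swap i j x ∈ S := by
    intro x hx
    rw [Equiv.swap_apply_def]
    split_ifs
    exacts [hj, hi, hx]
  have hmaps : ∀ J ∈ S.powersetCard k, J.image (Equiv.swap i j) ∈ S.powersetCard k := by
    intro J hJ
    rw [Finset.mem_powersetCard] at hJ ⊢
    refine ⟨?_, by rw [Finset.card_image_of_injective _ (Equiv.injective _), hJ.2]⟩
    exact Finset.image_subset_iff.mpr fun x hx => hS x (hJ.1 hx)
  have hinv : ∀ J ∈ S.powersetCard k,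
      (J.image (Equiv.swap i j)).image (Equiv.swap i j) = J := by
    intro J _
    ext x
    simp [Finset.image_image, Function.comp_def]
  rw [map_sum]
  exact Finset.sum_bij' (fun J _ => J.image (Equiv.swap i j)) (fun J _ => J.image (Equiv.swap i j))
    hmaps hmaps hinv hinv fun J hJ =>
      swapEnd_bplusTerm β (Finset.mem_powersetCard.mp hJ).1 hf hi hj

theorem DJ_Bplus_eq_zero (β : F) {k : ℕ} {S L : Finset (Fin M)} (hL : L ⊆ S)
    (hLk : L.card = k + 1) {f : MvPolynomial (Fin M) F} (hf : SymmOn S f)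
    (h0 : DJ β 0 L f = 0) : DJ β 0 L (Bplus β k S f) = 0 := by
  have hg : IsExchangeFamily β S k (bplusTerm β f) :=
    { swap_apply := fun J hJ _ i hi j hj => swapEnd_bplusTerm β hJ hf hi hj
      dunkl_apply := fun J hJ hJk a ha haJ => dunklEnd_bplusTerm β hJ hf ha haJ
        (DJ_eq_zero_of_card_eq β 0 hL (Finset.insert_subset ha hJ)
          (by rw [Finset.card_insert_of_notMem haJ, hJk, hLk]) hf h0) }
  rw [DJ_eq_cherednikProd β 0 hL L.nodup_toList (Finset.toList_toFinset L) (symmOn_Bplus β k hf),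
    Nat.cast_zero, zero_mul]
  change cherednikProd β 0 L.toList (∑ J ∈ S.powersetCard k, bplusTerm β f J) = 0
  rw [map_sum]
  refine Finset.sum_eq_zero fun J hJ => ?_
  rw [Finset.mem_powersetCard] at hJ
  exact hg.cherednikProd_apply_eq_zero hL hLk hJ.1 hJ.2

/-- `D_{k,J}` as a linear endomorphism. -/
noncomputable def djEnd (β : F) (k : ℕ) (J : Finset (Fin M)) :
    Module.End F (MvPolynomial (Fin M) F) :=
  dlistEnd β k (J.sort (· ≤ ·))

theorem djEnd_apply (β : F) (k : ℕ) (J : Finset (Fin M)) (f : MvPolynomial (Fin M) F) :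
    djEnd β k J f = DJ β k J f :=
  dlistEnd_apply β k _ f

/-- `B⁺_{k,S}` as a linear endomorphism. -/
noncomputable def bplusEnd (β : F) (k : ℕ) (S : Finset (Fin M)) :
    Module.End F (MvPolynomial (Fin M) F) :=
  ∑ J ∈ S.powersetCard k, LinearMap.mulLeft F (zJ J) * djEnd β 1 J

theorem bplusEnd_apply (β : F) (k : ℕ) (S : Finset (Fin M)) (f : MvPolynomial (Fin M) F) :
    bplusEnd β k S f = Bplus β k S f := by
  simp [bplusEnd, Bplus, LinearMap.sum_apply, djEnd_apply]

/-- The submodule of polynomials symmetric in the variables indexed by `S`. -/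
def symmSubmodule (F : Type*) [Field F] {M : ℕ} (S : Finset (Fin M)) :
    Submodule F (MvPolynomial (Fin M) F) where
  carrier := {f | SymmOn S f}
  add_mem' := fun ha hb i hi j hj => by rw [map_add, ha i hi j hj, hb i hi j hj]
  zero_mem' := fun _ _ _ _ => map_zero _
  smul_mem' := fun c _ ha i hi j hj => by rw [map_smul, ha i hi j hj]

end DunklAlgebra

theorem LinearMap.exists_comp_eqOn_of_ker_le {F V : Type*} [Field F] [AddCommGroup V] [Module F V]
    (W : Submodule F V) (φ ψ : V →ₗ[F] V) (h : ∀ v ∈ W, φ v = 0 → ψ v = 0) :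
    ∃ A : V →ₗ[F] V, ∀ v ∈ W, ψ v = A (φ v) := by
  obtain ⟨s, hs⟩ := (φ ∘ₗ W.subtype).rangeRestrict.exists_rightInverse_of_surjective
    (LinearMap.range_rangeRestrict _)
  obtain ⟨A, hA⟩ := LinearMap.exists_extend (ψ ∘ₗ W.subtype ∘ₗ s)
  refine ⟨A, fun v hv => ?_⟩
  set r := (φ ∘ₗ W.subtype).rangeRestrict ⟨v, hv⟩ with hr
  have h1 : φ (s r : V) = φ v :=
    congrArg Subtype.val (LinearMap.congr_fun hs r)
  have h2 : A (φ v) = ψ (s r : V) := LinearMap.congr_fun hA r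
  have h3 := h (v - s r) (W.sub_mem hv (s r).2) (by rw [map_sub, h1, sub_self])
  rw [h2, ← sub_eq_zero, ← map_sub, h3]

/-- with Dunkl operators built from `M ≥ N` variables, there is a linear
operator `A` with `[Ñ_{k+1}, B⁺_{k,{1,…,N}}] f = A (Ñ_{k+1} f)` for every `f` symmetric
in the variables `z_1,…,z_N`. (Indices are 0-indexed: `{1,…,n}` becomes `{x | x < n}`.) -/
theorem statement_8 {F : Type*} [Field F] [CharZero F] {M N : ℕ} (hMN : N ≤ M)
    (hN : 2 ≤ N) (β : F) (k : ℕ) (hk1 : 1 ≤ k) (hkN : k ≤ N - 1) :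
    ∃ A : MvPolynomial (Fin M) F →ₗ[F] MvPolynomial (Fin M) F,
      ∀ f : MvPolynomial (Fin M) F,
        SymmOn (Finset.univ.filter (fun x : Fin M => (x : ℕ) < N)) f →
        DJ β 0 (Finset.univ.filter (fun x : Fin M => (x : ℕ) < k + 1))
            (Bplus β k (Finset.univ.filter (fun x : Fin M => (x : ℕ) < N)) f)
          - Bplus β k (Finset.univ.filter (fun x : Fin M => (x : ℕ) < N))
              (DJ β 0 (Finset.univ.filter (fun x : Fin M => (x : ℕ) < k + 1)) f)
        = A (DJ β 0 (Finset.univ.filter (fun x : Fin M => (x : ℕ) < k + 1)) f) := by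
  set S := Finset.univ.filter (fun x : Fin M => (x : ℕ) < N)
  set L := Finset.univ.filter (fun x : Fin M => (x : ℕ) < k + 1) with hLdef
  have hLS : L ⊆ S := Finset.monotone_filter_right _ fun x _ hx => by
    change (x : ℕ) < k + 1 at hx
    omega
  have hLk : L.card = k + 1 := by
    rw [hLdef, Fin.card_filter_val_lt]
    omega
  obtain ⟨A, hA⟩ := LinearMap.exists_comp_eqOn_of_ker_le (symmSubmodule F S) (djEnd β 0 L)
    (djEnd β 0 L * bplusEnd β k S - bplusEnd β k S * djEnd β 0 L) (fun f hf h0 => by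
      rw [LinearMap.sub_apply, Module.End.mul_apply, Module.End.mul_apply, h0, map_zero, sub_zero,
        bplusEnd_apply, djEnd_apply]
      exact DJ_Bplus_eq_zero β hLS hLk hf (by rw [← djEnd_apply, h0]))
  refine ⟨A, fun f hf => ?_⟩
  simpa only [LinearMap.sub_apply, Module.End.mul_apply, bplusEnd_apply, djEnd_apply] using hA f hf
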